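/- arXiv:1303.5110 — 3 statements merged into one kernel-verified Lean document; each statement's English description precedes it below -/
import Mathlib

section
/- Let c1,c2,c3 ∈ ℝ satisfy 0 < |c2| < |c1|, 0 < |c2| < |c3|, and |c1| ≠ |c3|, and define f(p) = mid(|c1|(1−p)², |c2|, |c3|(1−p)²) for p ∈ [0,1] (the 1-norm geometric discord of a Bell-diagonal state with correlation vector (c1,c2,c3) evolved under the bit-phase-flip channel). Set p1 = 1 − √(|c2|/min(|c1|,|c3|)) and p2 = 1 − √(|c2|/max(|c1|,|c3|)). Then 0 < p1 < p2 < 1, and f(p) = min(|c1|,|c3|)·(1−p)² for p ∈ [0,p1], f(p) = |c2| for p ∈ [p1,p2] (freezing behavior), and f(p) = max(|c1|,|c3|)·(1−p)² for p ∈ [p2,1] (double sudden change). -/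
/-- The intermediate (median) value of three reals. -/
noncomputable def mid (a b c : ℝ) : ℝ := a + b + c - max a (max b c) - min a (min b c)

theorem mid_swap (a b c : ℝ) : mid a b c = mid c b a := by
  simp only [mid, max_comm, max_left_comm, min_comm, min_left_comm]
  ring

theorem mid_of_le_of_le {a b c : ℝ} (hab : a ≤ b) (hbc : b ≤ c) : mid a b c = b := by
  rw [mid, max_eq_right hbc, min_eq_left hbc, max_eq_right (hab.trans hbc), min_eq_left hab]
  ring

theorem mid_of_middle_le_left {a b c : ℝ} (hba : b ≤ a) (hac : a ≤ c) : mid a b c = a := by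
  rw [mid, max_eq_right (hba.trans hac), min_eq_left (hba.trans hac), max_eq_right hac,
    min_eq_right hba]
  ring

theorem mid_of_right_le_middle {a b c : ℝ} (hac : a ≤ c) (hcb : c ≤ b) : mid a b c = c := by
  rw [mid, max_eq_left hcb, min_eq_right hcb, max_eq_right (hac.trans hcb), min_eq_left hac]
  ring

theorem le_mul_sq_of_sqrt_div_le {a m s : ℝ} (ha : 0 < a) (hs : √(m / a) ≤ s) :
    m ≤ a * s ^ 2 := by
  rw [mul_comm]
  exact (div_le_iff₀ ha).1 (Real.sqrt_le_iff.1 hs).2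

theorem mul_sq_le_of_le_sqrt_div {a m s : ℝ} (ha : 0 < a) (hm : 0 ≤ m) (hs₀ : 0 ≤ s)
    (hs : s ≤ √(m / a)) : a * s ^ 2 ≤ m := by
  rw [mul_comm]
  exact (le_div_iff₀ ha).1 ((Real.le_sqrt hs₀ (div_nonneg hm ha.le)).1 hs)

/-- Double sudden change with intermediate freezing of the 1-norm geometric discord of a
Bell-diagonal state under the bit-phase-flip channel. -/
theorem bitPhaseFlip_doubleSuddenChange_freezing (c₁ c₂ c₃ : ℝ)
    (h₁ : 0 < |c₂|) (h₂ : |c₂| < |c₁|) (h₃ : |c₂| < |c₃|) (h₄ : |c₁| ≠ |c₃|)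
    (f : ℝ → ℝ) (hf : ∀ p, f p = mid (|c₁| * (1 - p) ^ 2) |c₂| (|c₃| * (1 - p) ^ 2))
    (p₁ p₂ : ℝ) (hp₁ : p₁ = 1 - Real.sqrt (|c₂| / min |c₁| |c₃|))
    (hp₂ : p₂ = 1 - Real.sqrt (|c₂| / max |c₁| |c₃|)) :
    0 < p₁ ∧ p₁ < p₂ ∧ p₂ < 1 ∧
    (∀ p ∈ Set.Icc (0 : ℝ) p₁, f p = min |c₁| |c₃| * (1 - p) ^ 2) ∧
    (∀ p ∈ Set.Icc p₁ p₂, f p = |c₂|) ∧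
    (∀ p ∈ Set.Icc p₂ (1 : ℝ), f p = max |c₁| |c₃| * (1 - p) ^ 2) := by
  have hmid : ∀ p, f p =
      mid (min |c₁| |c₃| * (1 - p) ^ 2) |c₂| (max |c₁| |c₃| * (1 - p) ^ 2) := by
    intro p
    rw [hf]
    rcases le_total |c₁| |c₃| with h | h
    · rw [min_eq_left h, max_eq_right h]
    · rw [min_eq_right h, max_eq_left h, mid_swap]
  have hlt : min |c₁| |c₃| < max |c₁| |c₃| := min_lt_max.2 h₄
  have hm : |c₂| < min |c₁| |c₃| := lt_min h₂ h₃
  generalize min |c₁| |c₃| = a at *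
  generalize max |c₁| |c₃| = b at *
  generalize |c₂| = m at *
  have ha : 0 < a := h₁.trans hm
  have hb : 0 < b := ha.trans hlt
  have hscale : ∀ p, a * (1 - p) ^ 2 ≤ b * (1 - p) ^ 2 := fun p => by gcongr
  subst hp₁ hp₂
  refine ⟨?_, ?_, ?_, ?_, ?_, ?_⟩
  · have : √(m / a) < 1 := by
      rw [Real.sqrt_lt' one_pos, one_pow, div_lt_one ha]
      exact hm
    linarith
  · have : √(m / b) < √(m / a) :=
      Real.sqrt_lt_sqrt (by positivity) (div_lt_div_of_pos_left h₁ ha hlt)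
    linarith
  · have : 0 < √(m / b) := Real.sqrt_pos.2 (by positivity)
    linarith
  · rintro p ⟨-, hp⟩
    rw [hmid, mid_of_middle_le_left (le_mul_sq_of_sqrt_div_le ha (by linarith)) (hscale p)]
  · rintro p ⟨hp, hp'⟩
    have hs : √(m / b) ≤ 1 - p := by linarith
    rw [hmid, mid_of_le_of_le
      (mul_sq_le_of_le_sqrt_div ha h₁.le ((Real.sqrt_nonneg _).trans hs) (by linarith))
      (le_mul_sq_of_sqrt_div_le hb hs)]
  · rintro p ⟨hp, hp'⟩
    rw [hmid, mid_of_right_le_middle (hscale p)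
      (mul_sq_le_of_le_sqrt_div hb h₁.le (by linarith) (by linarith))]
end

section
/- Let c1,c2,c3 ∈ ℝ and define f(p) = mid(|c1|(1−p)², |c2|, |c3|(1−p)²) for p ∈ [0,1]. Then the set {p ∈ (0,1) : f is not differentiable at p} has exactly two elements if and only if c2 ≠ 0, |c2| < |c1|, |c2| < |c3|, and |c1| ≠ |c3| (necessary and sufficient conditions for a double sudden change under the bit-phase-flip channel). -/
open Set Filter Topology

theorem mid_eq_max_min {x y z : ℝ} (h : x ≤ z) : mid x y z = max x (min y z) := by
  unfold mid
  grind

theorem mid_comm_outer (x y z : ℝ) : mid x y z = mid z y x := by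
  unfold mid
  grind

/-- A differentiable function that coincides with `g` on the left of `p` and with `h` on the right
of `p` forces the derivatives of `g` and `h` at `p` to agree. -/
theorem deriv_eq_of_eventuallyEq_left_right {f g h : ℝ → ℝ} {p g' h' : ℝ}
    (hf : DifferentiableAt ℝ f p) (hg : HasDerivAt g g' p) (hh : HasDerivAt h h' p)
    (hl : f =ᶠ[𝓝[<] p] g) (hr : f =ᶠ[𝓝[>] p] h) (hgp : f p = g p) (hhp : f p = h p) :
    g' = h' := by
  have h1 : HasDerivWithinAt f g' (Iio p) p := hg.hasDerivWithinAt.congr_of_eventuallyEq hl hgp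
  have h2 : HasDerivWithinAt f h' (Ioi p) p := hh.hasDerivWithinAt.congr_of_eventuallyEq hr hhp
  have e1 := (uniqueDiffWithinAt_Iio p).eq_deriv _ h1 hf.hasDerivAt.hasDerivWithinAt
  have e2 := (uniqueDiffWithinAt_Ioi p).eq_deriv _ h2 hf.hasDerivAt.hasDerivWithinAt
  exact e1.trans e2.symm

theorem hasDerivAt_const_mul_one_sub_sq (k p : ℝ) :
    HasDerivAt (fun q : ℝ => k * (1 - q) ^ 2) (-2 * k * (1 - p)) p := by
  refine ((((hasDerivAt_id' p).const_sub 1).fun_pow 2).const_mul k).congr_deriv ?_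
  push_cast
  ring

theorem eq_of_mul_one_sub_sq_eq {k b x y : ℝ} (hb : 0 < b) (hx : x < 1) (hy : y < 1)
    (hkx : k * (1 - x) ^ 2 = b) (hky : k * (1 - y) ^ 2 = b) : x = y := by
  have hk : k ≠ 0 := by
    rintro rfl
    linarith
  have h : (1 - x) ^ 2 = (1 - y) ^ 2 := mul_left_cancel₀ hk (hkx.trans hky.symm)
  have := (sq_eq_sq₀ (by linarith) (by linarith)).1 h
  linarith

theorem exists_mul_one_sub_sq_eq {k b : ℝ} (hb : 0 < b) (hk : b < k) :
    ∃ x ∈ Ioo (0 : ℝ) 1, k * (1 - x) ^ 2 = b := by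
  have hk0 : 0 < k := hb.trans hk
  have h1 : 0 < √(b / k) := Real.sqrt_pos.2 (by positivity)
  have h2 : √(b / k) < 1 := by
    rw [Real.sqrt_lt' one_pos, one_pow, div_lt_one hk0]
    exact hk
  refine ⟨1 - √(b / k), ⟨by linarith, by linarith⟩, ?_⟩
  rw [sub_sub_cancel, Real.sq_sqrt (by positivity)]
  field_simp

section Median

variable {m M b : ℝ} {f : ℝ → ℝ}

theorem crossing_of_not_differentiableAt (hm : 0 ≤ m) (hmM : m ≤ M) (hb : 0 ≤ b)
    (hf : ∀ p, f p = max (m * (1 - p) ^ 2) (min b (M * (1 - p) ^ 2))) {p : ℝ}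
    (hnd : ¬ DifferentiableAt ℝ f p) :
    0 < b ∧ m < M ∧ (m * (1 - p) ^ 2 = b ∨ M * (1 - p) ^ 2 = b) := by
  have hc (k : ℝ) : ContinuousAt (fun q : ℝ => k * (1 - q) ^ 2) p :=
    (hasDerivAt_const_mul_one_sub_sq k p).continuousAt
  have hd (k : ℝ) : DifferentiableAt ℝ (fun q : ℝ => k * (1 - q) ^ 2) p :=
    (hasDerivAt_const_mul_one_sub_sq k p).differentiableAt
  have hle (q : ℝ) : m * (1 - q) ^ 2 ≤ M * (1 - q) ^ 2 := by gcongr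
  refine ⟨lt_of_le_of_ne hb ?_, lt_of_le_of_ne hmM ?_, ?_⟩
  · rintro rfl
    refine hnd ((hd m).congr_of_eventuallyEq (.of_forall fun q => ?_))
    have : 0 ≤ m * (1 - q) ^ 2 := by positivity
    rw [hf, max_eq_left ((min_le_left _ _).trans this)]
  · rintro rfl
    refine hnd ((hd m).congr_of_eventuallyEq (.of_forall fun q => ?_))
    rw [hf, max_eq_left (min_le_right _ _)]
  · by_contra! h
    rcases lt_or_gt_of_ne h.2 with h2 | h2
    · refine hnd ((hd M).congr_of_eventuallyEq ?_)
      filter_upwards [(hc M).eventually_lt_const h2] with q hq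
      rw [hf, min_eq_right hq.le, max_eq_right (hle q)]
    rcases lt_or_gt_of_ne h.1 with h1 | h1
    · refine hnd ((differentiableAt_const b).congr_of_eventuallyEq ?_)
      filter_upwards [(hc M).eventually_const_lt h2, (hc m).eventually_lt_const h1] with q hq hq'
      rw [hf, min_eq_left hq.le, max_eq_right hq'.le]
    · refine hnd ((hd m).congr_of_eventuallyEq ?_)
      filter_upwards [(hc m).eventually_const_lt h1] with q hq
      rw [hf, max_eq_left ((min_le_left _ _).trans hq.le)]

theorem not_differentiableAt_of_crossing (hm : 0 < m) (hmM : m < M)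
    (hf : ∀ p, f p = max (m * (1 - p) ^ 2) (min b (M * (1 - p) ^ 2))) {p : ℝ} (hp : p < 1)
    (h : m * (1 - p) ^ 2 = b ∨ M * (1 - p) ^ 2 = b) : ¬ DifferentiableAt ℝ f p := by
  intro hd
  have hM : 0 < M := hm.trans hmM
  have hc (k : ℝ) : ContinuousAt (fun q : ℝ => k * (1 - q) ^ 2) p :=
    (hasDerivAt_const_mul_one_sub_sq k p).continuousAt
  have hs : 0 < (1 - p) ^ 2 := by
    have : 0 < 1 - p := by linarith
    positivity
  have hlt : m * (1 - p) ^ 2 < M * (1 - p) ^ 2 := by gcongr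
  have hleft {k : ℝ} (hk : 0 < k) :
      ∀ᶠ q in 𝓝[<] p, k * (1 - p) ^ 2 < k * (1 - q) ^ 2 := by
    filter_upwards [self_mem_nhdsWithin] with q hq
    have : 1 - p < 1 - q := sub_lt_sub_left hq 1
    have : 0 ≤ 1 - p := by linarith
    gcongr
  have hright {k : ℝ} (hk : 0 < k) :
      ∀ᶠ q in 𝓝[>] p, k * (1 - q) ^ 2 < k * (1 - p) ^ 2 := by
    filter_upwards [Ioo_mem_nhdsGT hp] with q hq
    have : 1 - q < 1 - p := sub_lt_sub_left hq.1 1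
    have : 0 ≤ 1 - q := by linarith [hq.2]
    gcongr
  rcases h with h | h
  · have h2 : b < M * (1 - p) ^ 2 := h ▸ hlt
    have hev := ((hc M).eventually_const_lt h2)
    have key := deriv_eq_of_eventuallyEq_left_right hd (hasDerivAt_const_mul_one_sub_sq m p)
      (hasDerivAt_const p b)
      (by
        filter_upwards [hleft hm] with q hq
        rw [hf, max_eq_left ((min_le_left _ _).trans (h ▸ hq.le))])
      (by
        filter_upwards [hright hm, hev.filter_mono nhdsWithin_le_nhds] with q hq hq'
        rw [hf, min_eq_left hq'.le, max_eq_right (h ▸ hq.le)])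
      (by rw [hf, h, max_eq_left (min_le_left _ _)])
      (by rw [hf, h, max_eq_left (min_le_left _ _)])
    nlinarith
  · have h2 : m * (1 - p) ^ 2 < b := h ▸ hlt
    have hev := ((hc m).eventually_lt_const h2)
    have hp' : f p = b := by rw [hf, h, min_self, max_eq_right h2.le]
    have key := deriv_eq_of_eventuallyEq_left_right hd (hasDerivAt_const p b)
      (hasDerivAt_const_mul_one_sub_sq M p)
      (by
        filter_upwards [hleft hM, hev.filter_mono nhdsWithin_le_nhds] with q hq hq'
        rw [hf, min_eq_left (h ▸ hq.le), max_eq_right hq'.le])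
      (by
        filter_upwards [hright hM] with q hq
        have : m * (1 - q) ^ 2 ≤ M * (1 - q) ^ 2 := by gcongr
        rw [hf, min_eq_right (h ▸ hq.le), max_eq_right this])
      hp' (hp'.trans h.symm)
    nlinarith

theorem ncard_not_differentiableAt_eq_two_iff (hm : 0 ≤ m) (hmM : m ≤ M) (hb : 0 ≤ b)
    (hf : ∀ p, f p = max (m * (1 - p) ^ 2) (min b (M * (1 - p) ^ 2))) :
    {p ∈ Ioo (0 : ℝ) 1 | ¬ DifferentiableAt ℝ f p}.ncard = 2 ↔ 0 < b ∧ b < m ∧ m < M := by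
  constructor
  · intro h
    obtain ⟨x, y, hxy, hS⟩ := ncard_eq_two.1 h
    have hx : x ∈ {p ∈ Ioo (0 : ℝ) 1 | ¬ DifferentiableAt ℝ f p} := by
      rw [hS]
      simp
    have hy : y ∈ {p ∈ Ioo (0 : ℝ) 1 | ¬ DifferentiableAt ℝ f p} := by
      rw [hS]
      simp
    obtain ⟨hb', hlt, hx'⟩ := crossing_of_not_differentiableAt hm hmM hb hf hx.2
    obtain ⟨-, -, hy'⟩ := crossing_of_not_differentiableAt hm hmM hb hf hy.2
    have hbm {z : ℝ} (hz : z ∈ Ioo (0 : ℝ) 1) (h : m * (1 - z) ^ 2 = b) : b < m := by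
      have hs : (1 - z) ^ 2 < 1 := by nlinarith [hz.1, hz.2]
      have hm' : 0 < m := lt_of_le_of_ne hm (by rintro rfl; linarith)
      nlinarith
    refine ⟨hb', ?_, hlt⟩
    rcases hx' with hx' | hx'
    · exact hbm hx.1 hx'
    rcases hy' with hy' | hy'
    · exact hbm hy.1 hy'
    exact absurd (eq_of_mul_one_sub_sq_eq hb' hx.1.2 hy.1.2 hx' hy') hxy
  · rintro ⟨hb', hbm, hlt⟩
    obtain ⟨x, hx, hx'⟩ := exists_mul_one_sub_sq_eq hb' hbm
    obtain ⟨y, hy, hy'⟩ := exists_mul_one_sub_sq_eq hb' (hbm.trans hlt)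
    refine ncard_eq_two.2 ⟨x, y, ?_, ?_⟩
    · rintro rfl
      have : (0 : ℝ) < (1 - x) ^ 2 := by nlinarith [hx.2]
      nlinarith
    · ext p
      simp only [mem_ofPred_eq, mem_insert_iff, mem_singleton_iff]
      constructor
      · rintro ⟨hp, hnd⟩
        obtain ⟨-, -, h | h⟩ := crossing_of_not_differentiableAt hm hmM hb hf hnd
        · exact .inl (eq_of_mul_one_sub_sq_eq hb' hp.2 hx.2 h hx')
        · exact .inr (eq_of_mul_one_sub_sq_eq hb' hp.2 hy.2 h hy')
      · rintro (rfl | rfl)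
        · exact ⟨hx, not_differentiableAt_of_crossing (hb'.trans hbm) hlt hf hx.2 (.inl hx')⟩
        · exact ⟨hy, not_differentiableAt_of_crossing (hb'.trans hbm) hlt hf hy.2 (.inr hy')⟩

end Median

/-- Necessary and sufficient conditions for a double sudden change of the 1-norm geometric
discord under the bit-phase-flip channel. -/
theorem bitPhaseFlip_doubleSuddenChange_iff (c₁ c₂ c₃ : ℝ) (f : ℝ → ℝ)
    (hf : ∀ p, f p = mid (|c₁| * (1 - p) ^ 2) |c₂| (|c₃| * (1 - p) ^ 2)) :
    {p ∈ Set.Ioo (0 : ℝ) 1 | ¬ DifferentiableAt ℝ f p}.ncard = 2 ↔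
      c₂ ≠ 0 ∧ |c₂| < |c₁| ∧ |c₂| < |c₃| ∧ |c₁| ≠ |c₃| := by
  rw [← abs_pos]
  rcases le_total |c₁| |c₃| with h | h
  · rw [ncard_not_differentiableAt_eq_two_iff (abs_nonneg c₁) h (abs_nonneg c₂) fun p => by
      rw [hf, mid_eq_max_min (by gcongr)]]
    grind
  · rw [ncard_not_differentiableAt_eq_two_iff (abs_nonneg c₃) h (abs_nonneg c₂) fun p => by
      rw [hf, mid_comm_outer, mid_eq_max_min (by gcongr)]]
    grind
end

section
/- (Proposition, bit-flip case) Let c1,c2,c3 ∈ ℝ and define the 2-norm geometric discord under the bit-flip channel as D2(p) = (1/4)·[c1² + c2²(1−p)⁴ + c3²(1−p)⁴ − max(c1², c2²(1−p)⁴, c3²(1−p)⁴)] for p ∈ [0,1]. Then (a) the set {p ∈ (0,1) : D2 is not differentiable at p} has at most one element (no double sudden change), and (b) if c1 ≠ 0, c2 ≠ 0, and c3 ≠ 0, then D2 is strictly decreasing on [0,1]; in particular D2 is not constant on any nondegenerate subinterval of [0,1] (no nonvanishing freezing). -/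
theorem DifferentiableAt.min_of_ne {f g : ℝ → ℝ} {x : ℝ} (hf : DifferentiableAt ℝ f x)
    (hg : DifferentiableAt ℝ g x) (hne : f x ≠ g x) :
    DifferentiableAt ℝ (fun y => min (f y) (g y)) x := by
  rcases lt_or_gt_of_ne hne with h | h
  · refine hf.congr_of_eventuallyEq ?_
    filter_upwards [hf.continuousAt.eventually_lt hg.continuousAt h] with y hy
    exact min_eq_left hy.le
  · refine hg.congr_of_eventuallyEq ?_
    filter_upwards [hg.continuousAt.eventually_lt hf.continuousAt h] with y hy
    exact min_eq_right hy.le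

theorem add_add_sub_max_eq_min_mul_add_min {a b c t : ℝ} (ht : 0 ≤ t) :
    a + b * t + c * t - max a (max (b * t) (c * t)) = min b c * t + min a (max b c * t) := by
  rw [← max_mul_of_nonneg _ _ ht]
  linear_combination t * (min_add_max b c).symm + (min_add_max a (max b c * t)).symm

theorem strictAntiOn_one_sub_pow_four :
    StrictAntiOn (fun p : ℝ => (1 - p) ^ 4) (Set.Icc 0 1) := by
  intro p _ q hq hpq
  exact pow_lt_pow_left₀ (by linarith) (by linarith [hq.2]) (by norm_num)

/-- The 2-norm (Hilbert–Schmidt) geometric discord of a Bell-diagonal state evolving under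
the bit-flip channel has at most one sudden change and, for nontrivial states, no
nonvanishing freezing behavior. -/
theorem twoNorm_bitFlip_no_double_no_freezing (c₁ c₂ c₃ : ℝ) (D₂ : ℝ → ℝ)
    (hD : ∀ p, D₂ p = (1 / 4) * (c₁ ^ 2 + c₂ ^ 2 * (1 - p) ^ 4 + c₃ ^ 2 * (1 - p) ^ 4
      - max (c₁ ^ 2) (max (c₂ ^ 2 * (1 - p) ^ 4) (c₃ ^ 2 * (1 - p) ^ 4)))) :
    {p ∈ Set.Ioo (0 : ℝ) 1 | ¬ DifferentiableAt ℝ D₂ p}.ncard ≤ 1 ∧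
    (c₁ ≠ 0 → c₂ ≠ 0 → c₃ ≠ 0 →
      StrictAntiOn D₂ (Set.Icc 0 1) ∧
      ∀ a b : ℝ, a ∈ Set.Icc (0 : ℝ) 1 → b ∈ Set.Icc (0 : ℝ) 1 → a < b →
        ¬ ∀ x ∈ Set.Icc a b, D₂ x = D₂ a) := by
  have hD' : D₂ = fun p => (1 / 4) * (min (c₂ ^ 2) (c₃ ^ 2) * (1 - p) ^ 4
      + min (c₁ ^ 2) (max (c₂ ^ 2) (c₃ ^ 2) * (1 - p) ^ 4)) := by
    funext p
    rw [hD, add_add_sub_max_eq_min_mul_add_min (by positivity)]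
  clear hD
  have hm : 0 ≤ max (c₂ ^ 2) (c₃ ^ 2) := le_max_of_le_left (sq_nonneg c₂)
  have hn : c₂ ≠ 0 → c₃ ≠ 0 → 0 < min (c₂ ^ 2) (c₃ ^ 2) := fun h₂ h₃ =>
    lt_min (by positivity) (by positivity)
  generalize max (c₂ ^ 2) (c₃ ^ 2) = m at *
  generalize min (c₂ ^ 2) (c₃ ^ 2) = n at *
  refine ⟨?_, fun _ h₂ h₃ => ?_⟩
  · have key : ∀ p, ¬ DifferentiableAt ℝ D₂ p → m ≠ 0 ∧ c₁ ^ 2 = m * (1 - p) ^ 4 := by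
      intro p hp
      constructor
      · rintro rfl
        apply hp
        simp only [hD', zero_mul]
        fun_prop
      · by_contra hne
        have hmin : DifferentiableAt ℝ (fun q : ℝ => min (c₁ ^ 2) (m * (1 - q) ^ 4)) p :=
          DifferentiableAt.min_of_ne (by fun_prop) (by fun_prop) hne
        apply hp
        rw [hD']
        fun_prop
    have hsub : {p ∈ Set.Ioo (0 : ℝ) 1 | ¬ DifferentiableAt ℝ D₂ p}.Subsingleton := by
      rintro p ⟨hp, hp'⟩ q ⟨hq, hq'⟩
      obtain ⟨hm0, hpe⟩ := key p hp'
      obtain ⟨-, hqe⟩ := key q hq'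
      exact strictAntiOn_one_sub_pow_four.injOn (Set.Ioo_subset_Icc_self hp)
        (Set.Ioo_subset_Icc_self hq) (mul_left_cancel₀ hm0 (hpe.symm.trans hqe))
    have := hsub.finite.to_subtype
    exact Set.ncard_le_one_iff_subsingleton.2 hsub
  · have hanti : StrictAntiOn D₂ (Set.Icc 0 1) := by
      intro p hp q hq hpq
      have ht : (1 - q) ^ 4 < (1 - p) ^ 4 := strictAntiOn_one_sub_pow_four hp hq hpq
      have h₁ := mul_lt_mul_of_pos_left ht (hn h₂ h₃)
      have h₂ := min_le_min_left (c₁ ^ 2) (mul_le_mul_of_nonneg_left ht.le hm)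
      simp only [hD']
      linarith
    exact ⟨hanti, fun a b ha hb hab h => (hanti ha hb hab).ne (h b ⟨hab.le, le_rfl⟩)⟩
end
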